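/- arXiv:0707.0686 — 2 statements merged into one kernel-verified Lean document; each statement's English description precedes it below -/
import Mathlib

section
/- For every α = (α_1,…,α_n) ∈ ℂⁿ, the Weyl-displaced coefficients K_α := K + Σ_{i,j} ᾱ_i (S_{ij} − δ_{ij}I) α_j + Σ_i ᾱ_i L_i − Σ_{i,j} α_j L_i† S_{ij} and L_{i,α} := L_i + Σ_j α_j (S_{ij} − δ_{ij}I) again satisfy the unitarity relation K_α + K_α† = −Σ_{i=1}^n L_{i,α}† L_{i,α}. -/
open ContinuousLinearMap Finset

/-- Bouten–Silberfarb, Section 4 (displaced QSDE): if K + K† = −Σᵢ Lᵢ†Lᵢ and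
Σₗ S_{li}†S_{lj} = δᵢⱼ I, then the Weyl-displaced coefficients
K_α = K + Σᵢⱼ ᾱᵢ(Sᵢⱼ − δᵢⱼ)αⱼ + Σᵢ ᾱᵢLᵢ − Σᵢⱼ αⱼLᵢ†Sᵢⱼ and
L_{i,α} = Lᵢ + Σⱼ αⱼ(Sᵢⱼ − δᵢⱼ) again satisfy K_α + K_α† = −Σᵢ L_{i,α}†L_{i,α}. -/
theorem displaced_unitarity
    {H : Type*} [NormedAddCommGroup H] [InnerProductSpace ℂ H] [CompleteSpace H]
    {n : ℕ} (hn : 0 < n)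
    (K : H →L[ℂ] H) (L : Fin n → H →L[ℂ] H) (S : Fin n → Fin n → H →L[ℂ] H)
    (hK : K + adjoint K = -∑ i, adjoint (L i) * L i)
    (hS : ∀ i j, ∑ l, adjoint (S l i) * S l j = if i = j then 1 else 0)
    (α : Fin n → ℂ)
    (Kα : H →L[ℂ] H) (Lα : Fin n → H →L[ℂ] H)
    (hKα : Kα = K + ∑ i, ∑ j, (starRingEnd ℂ (α i) * α j) • (S i j - if i = j then 1 else 0)
        + ∑ i, (starRingEnd ℂ (α i)) • L i
        - ∑ i, ∑ j, α j • (adjoint (L i) * S i j))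
    (hLα : ∀ i, Lα i = L i + ∑ j, α j • (S i j - if i = j then 1 else 0)) :
    Kα + adjoint Kα = -∑ i, adjoint (Lα i) * Lα i := by
  have hM : ∃ M : Fin n → H →L[ℂ] H, ∀ i, M i = ∑ j, α j • S i j := ⟨_, fun _ => rfl⟩
  obtain ⟨M, hM⟩ := hM
  have hL' : ∀ i, Lα i = L i + M i - α i • (1 : H →L[ℂ] H) := by
    intro i
    rw [hLα, hM]
    simp only [smul_sub, Finset.sum_sub_distrib, smul_ite, smul_zero, Finset.sum_ite_eq,
      Finset.mem_univ, if_true]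
    abel
  have hK' : Kα = K + ∑ i, (starRingEnd ℂ (α i) • M i
      - (starRingEnd ℂ (α i) * α i) • (1 : H →L[ℂ] H)
      + starRingEnd ℂ (α i) • L i - adjoint (L i) * M i) := by
    rw [hKα]
    simp only [hM, smul_sub, Finset.sum_sub_distrib, Finset.sum_add_distrib, smul_ite, smul_zero,
      Finset.sum_ite_eq, Finset.mem_univ, if_true, Finset.smul_sum, smul_smul, Finset.mul_sum,
      mul_smul_comm]
    abel
  have hMM : ∑ i, adjoint (M i) * M i
      = ∑ i, (starRingEnd ℂ (α i) * α i) • (1 : H →L[ℂ] H) := by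
    have h1 : ∀ l, adjoint (M l) * M l
        = ∑ i, ∑ j, (starRingEnd ℂ (α i) * α j) • (adjoint (S l i) * S l j) := by
      intro l
      rw [hM, map_sum, Finset.sum_mul_sum]
      refine Finset.sum_congr rfl fun i _ => Finset.sum_congr rfl fun j _ => ?_
      rw [map_smulₛₗ, smul_mul_smul_comm]
    simp only [h1]
    rw [Finset.sum_comm]
    refine Finset.sum_congr rfl fun i _ => ?_
    rw [Finset.sum_comm]
    simp only [← Finset.smul_sum, hS, smul_ite, smul_zero, Finset.sum_ite_eq,
      Finset.mem_univ, if_true]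
  have ha1 : adjoint (1 : H →L[ℂ] H) = 1 := star_one (H →L[ℂ] H)
  have ham : ∀ A B : H →L[ℂ] H, adjoint (A * B) = adjoint B * adjoint A := fun A B => star_mul A B
  have hexp : ∀ i, adjoint (Lα i) * Lα i = adjoint (L i) * L i + adjoint (M i) * M i
      + adjoint (L i) * M i + adjoint (M i) * L i - α i • adjoint (L i)
      - starRingEnd ℂ (α i) • L i - α i • adjoint (M i) - starRingEnd ℂ (α i) • M i
      + (starRingEnd ℂ (α i) * α i) • (1 : H →L[ℂ] H) := by
    intro i
    rw [hL', map_sub, map_add, map_smulₛₗ, ha1]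
    simp only [sub_mul, mul_sub, add_mul, mul_add, smul_mul_assoc, mul_smul_comm, one_mul, mul_one,
      smul_sub, smul_add, smul_smul]
    rw [mul_comm (α i)]
    abel
  have hKK : Kα + adjoint Kα = (K + adjoint K) + ∑ i, (starRingEnd ℂ (α i) • M i
      - (starRingEnd ℂ (α i) * α i) • (1 : H →L[ℂ] H)
      + starRingEnd ℂ (α i) • L i - adjoint (L i) * M i
      + (α i • adjoint (M i) - (starRingEnd ℂ (α i) * α i) • (1 : H →L[ℂ] H)
      + α i • adjoint (L i) - adjoint (M i) * L i)) := by
    rw [hK', Finset.sum_add_distrib, map_add, map_sum]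
    have : ∀ i, adjoint (starRingEnd ℂ (α i) • M i
      - (starRingEnd ℂ (α i) * α i) • (1 : H →L[ℂ] H)
      + starRingEnd ℂ (α i) • L i - adjoint (L i) * M i) =
      (α i • adjoint (M i) - (starRingEnd ℂ (α i) * α i) • (1 : H →L[ℂ] H)
      + α i • adjoint (L i) - adjoint (M i) * L i) := by
      intro i
      simp only [map_sub, map_add, map_smulₛₗ, ha1, ham, adjoint_adjoint, map_mul,
        Complex.conj_conj]
      rw [mul_comm (α i)]
    simp only [this]
    abel
  rw [hKK, hK]
  simp only [hexp, Finset.sum_add_distrib, Finset.sum_sub_distrib, hMM]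
  abel
end

section
/- P0 := P_g ⊗ I is the orthogonal projection onto the kernel of Y, and for all i, j ∈ {x, y, z} the eliminated scattering coefficients S_{ij} := Σ_{l∈{x,y,z}} (δ_{il} + F_i Y₁⁻¹ F_l†) W_{lj} P0 are given explicitly by S_{ij} = P_g ⊗ ( δ_{ij} I − (γ / (iΔ + 3γ/2)) σ_i σ_j ). -/
open Matrix Kronecker

/-- Bouten–Silberfarb, Example 2 (alkali atom): P0 = P_g ⊗ I is the orthogonal
projection onto ker Y, and the eliminated scattering coefficients
S_{ij} = Σₗ(δ_{il} + F_i Y₁⁻¹ F_l†)W_{lj} P0 are given by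
S_{ij} = P_g ⊗ (δ_{ij} I − (γ/(iΔ + 3γ/2)) σᵢσⱼ). -/
theorem alkali_atom_eliminated_scattering
    (Δ : ℝ) (γ : ℝ) (hγ : 0 < γ)
    (σ : Fin 3 → Matrix (Fin 2) (Fin 2) ℂ)
    (hσx : σ 0 = !![0, 1; 1, 0])
    (hσy : σ 1 = !![0, -Complex.I; Complex.I, 0])
    (hσz : σ 2 = !![1, 0; 0, -1])
    (σm Pe Pg : Matrix (Fin 2) (Fin 2) ℂ)
    (hσm : σm = !![0, 0; 1, 0]) (hPe : Pe = !![1, 0; 0, 0]) (hPg : Pg = !![0, 0; 0, 1])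
    (Y Yinv P0 : Matrix (Fin 2 × Fin 2) (Fin 2 × Fin 2) ℂ)
    (F : Fin 3 → Matrix (Fin 2 × Fin 2) (Fin 2 × Fin 2) ℂ)
    (W : Fin 3 → Fin 3 → Matrix (Fin 2 × Fin 2) (Fin 2 × Fin 2) ℂ)
    (hY : Y = (-(Complex.I * Δ) - 3 * (γ : ℂ) / 2) • (Pe ⊗ₖ 1))
    (hF : ∀ i, F i = ((Real.sqrt γ : ℝ) : ℂ) • (σm ⊗ₖ σ i))
    (hW : ∀ i j, W i j = if i = j then 1 else 0)
    (hYinv : Yinv = (-(Complex.I * Δ + 3 * (γ : ℂ) / 2)⁻¹) • (Pe ⊗ₖ 1))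
    (hP0 : P0 = Pg ⊗ₖ 1) :
    (P0ᴴ = P0 ∧ P0 * P0 = P0 ∧
      LinearMap.range P0.mulVecLin = LinearMap.ker Y.mulVecLin) ∧
    ∀ i j, (∑ l, ((if i = l then 1 else 0) + F i * Yinv * (F l)ᴴ) * W l j) * P0
      = Pg ⊗ₖ ((if i = j then 1 else 0)
          - ((γ : ℂ) / (Complex.I * Δ + 3 * (γ : ℂ) / 2)) • (σ i * σ j)) := by
  have hσH : ∀ i, (σ i)ᴴ = σ i := by
    intro i
    fin_cases i
    · simp only [Fin.zero_eta, hσx]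
      ext a b; fin_cases a <;> fin_cases b <;> simp
    · simp only [Fin.mk_one, hσy]
      ext a b; fin_cases a <;> fin_cases b <;> simp
    · simp only [Fin.reduceFinMk, hσz]
      ext a b; fin_cases a <;> fin_cases b <;> simp
  have hPgH : Pgᴴ = Pg := by
    subst hPg
    ext a b; fin_cases a <;> fin_cases b <;> simp
  have hPgPg : Pg * Pg = Pg := by
    subst hPg
    ext a b; fin_cases a <;> fin_cases b <;> simp
  have hPePg : Pe * Pg = 0 := by
    subst hPg hPe
    ext a b; fin_cases a <;> fin_cases b <;> simp
  have hsum : Pe + Pg = 1 := by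
    subst hPg hPe
    ext a b; fin_cases a <;> fin_cases b <;> simp
  have hm : σm * Pe * σmᴴ = Pg := by
    subst hPg hPe hσm
    ext a b; fin_cases a <;> fin_cases b <;> simp [Matrix.mul_apply, Fin.sum_univ_two]
  have hc : (-(Complex.I * Δ) - 3 * (γ : ℂ) / 2) ≠ 0 := by
    intro h
    have h2 := congrArg Complex.re h
    simp at h2
    linarith
  have hPP : P0 * P0 = P0 := by
    rw [hP0, ← Matrix.mul_kronecker_mul, hPgPg, one_mul]
  refine ⟨⟨?_, hPP, ?_⟩, ?_⟩
  · rw [hP0, Matrix.conjTranspose_kronecker, hPgH, Matrix.conjTranspose_one]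
  · ext v
    simp only [LinearMap.mem_range, LinearMap.mem_ker, Matrix.mulVecLin_apply]
    constructor
    · rintro ⟨w, rfl⟩
      rw [Matrix.mulVec_mulVec, hY, hP0, Matrix.smul_mul, ← Matrix.mul_kronecker_mul, hPePg]
      simp
    · intro h
      refine ⟨v, ?_⟩
      rw [hY, Matrix.smul_mulVec, smul_eq_zero] at h
      have h1 := h.resolve_left hc
      have h2 : (Pe ⊗ₖ (1 : Matrix (Fin 2) (Fin 2) ℂ)) + P0 = 1 := by
        rw [hP0, ← Matrix.add_kronecker, hsum, Matrix.one_kronecker_one]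
      have h3 : ((Pe ⊗ₖ (1 : Matrix (Fin 2) (Fin 2) ℂ)) + P0) *ᵥ v = v := by
        rw [h2, Matrix.one_mulVec]
      rwa [Matrix.add_mulVec, h1, zero_add] at h3
  · intro i j
    have hs : ((Real.sqrt γ : ℝ) : ℂ) * ((Real.sqrt γ : ℝ) : ℂ) = γ := by
      rw [← Complex.ofReal_mul, Real.mul_self_sqrt hγ.le]
    have hFYF : F i * Yinv * (F j)ᴴ
        = (-((γ : ℂ) / (Complex.I * Δ + 3 * (γ : ℂ) / 2))) • (Pg ⊗ₖ (σ i * σ j)) := by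
      rw [hF, hF, hYinv, Matrix.conjTranspose_smul, Matrix.conjTranspose_kronecker, hσH]
      simp only [Matrix.smul_mul, Matrix.mul_smul, smul_smul, ← Matrix.mul_kronecker_mul, hm,
        mul_one]
      congr 1
      rw [← hs]
      simp only [Complex.star_def, Complex.conj_ofReal]
      ring
    have hS : (∑ l, ((if i = l then 1 else 0) + F i * Yinv * (F l)ᴴ) * W l j)
        = (if i = j then 1 else 0) + F i * Yinv * (F j)ᴴ := by
      simp only [hW, mul_ite, mul_one, mul_zero, Finset.sum_ite_eq', Finset.mem_univ, if_true]
    rw [hS, hFYF, add_mul, Matrix.smul_mul, hP0, ← Matrix.mul_kronecker_mul, hPgPg, mul_one,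
      sub_eq_add_neg, Matrix.kronecker_add, ← neg_smul, Matrix.kronecker_smul]
    congr 1
    split_ifs <;> simp
end
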